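/- Assume A, B are not both such that Aᵀ G = 0 and G B = 0. If C^A ≥ 0, C^B ≥ 0, and C > 0, then any pair (α*, β*) with α*² = C^A / (Lη C) and β*² = C^B / (Lη C) is a global minimizer of f over ℝ². -/

import Mathlib

open Matrix

/-- Frobenius norm of a real matrix. -/
noncomputable def fnorm {m n : ℕ} (M : Matrix (Fin m) (Fin n) ℝ) : ℝ :=
  Real.sqrt (∑ i, ∑ j, (M i j) ^ 2)

/-- The scalar-scaling objective f(α, β) := (L/2) ‖ (1/L) G − η β² G B Bᵀ − η α² A Aᵀ G ‖_F². -/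
noncomputable def scalObj {m n r : ℕ} (L η : ℝ) (G : Matrix (Fin m) (Fin n) ℝ)
    (A : Matrix (Fin m) (Fin r) ℝ) (B : Matrix (Fin n) (Fin r) ℝ) (α β : ℝ) : ℝ :=
  (L / 2) *
    (fnorm ((1 / L) • G - (η * β ^ 2) • (G * B * Bᵀ) - (η * α ^ 2) • (A * Aᵀ * G))) ^ 2

/-- C^A := ‖Aᵀ G‖_F² ‖G B Bᵀ‖_F² − ‖G B‖_F² ‖Aᵀ G B‖_F². -/
noncomputable def CA {m n r : ℕ} (G : Matrix (Fin m) (Fin n) ℝ)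
    (A : Matrix (Fin m) (Fin r) ℝ) (B : Matrix (Fin n) (Fin r) ℝ) : ℝ :=
  (fnorm (Aᵀ * G)) ^ 2 * (fnorm (G * B * Bᵀ)) ^ 2 -
    (fnorm (G * B)) ^ 2 * (fnorm (Aᵀ * G * B)) ^ 2

/-- C^B := ‖G B‖_F² ‖A Aᵀ G‖_F² − ‖Aᵀ G‖_F² ‖Aᵀ G B‖_F². -/
noncomputable def CB {m n r : ℕ} (G : Matrix (Fin m) (Fin n) ℝ)
    (A : Matrix (Fin m) (Fin r) ℝ) (B : Matrix (Fin n) (Fin r) ℝ) : ℝ :=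
  (fnorm (G * B)) ^ 2 * (fnorm (A * Aᵀ * G)) ^ 2 -
    (fnorm (Aᵀ * G)) ^ 2 * (fnorm (Aᵀ * G * B)) ^ 2

/-- C := ‖A Aᵀ G‖_F² ‖G B Bᵀ‖_F² − ‖Aᵀ G B‖_F⁴. -/
noncomputable def CC {m n r : ℕ} (G : Matrix (Fin m) (Fin n) ℝ)
    (A : Matrix (Fin m) (Fin r) ℝ) (B : Matrix (Fin n) (Fin r) ℝ) : ℝ :=
  (fnorm (A * Aᵀ * G)) ^ 2 * (fnorm (G * B * Bᵀ)) ^ 2 - (fnorm (Aᵀ * G * B)) ^ 4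

theorem fnorm_sq {m n : ℕ} (M : Matrix (Fin m) (Fin n) ℝ) :
    fnorm M ^ 2 = (Mᵀ * M).trace := by
  rw [fnorm, Real.sq_sqrt (by positivity), Finset.sum_comm]
  simp [Matrix.trace, Matrix.mul_apply, sq]

theorem fnorm_sq_sub_sub {m n : ℕ} (X Y Z : Matrix (Fin m) (Fin n) ℝ) (c y x : ℝ) :
    fnorm (c • Z - y • Y - x • X) ^ 2 =
      c ^ 2 * fnorm Z ^ 2 + y ^ 2 * fnorm Y ^ 2 + x ^ 2 * fnorm X ^ 2
        - 2 * c * y * (Zᵀ * Y).trace - 2 * c * x * (Zᵀ * X).trace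
        + 2 * x * y * (Xᵀ * Y).trace := by
  have symm (U V : Matrix (Fin m) (Fin n) ℝ) : (Uᵀ * V).trace = (Vᵀ * U).trace := by
    rw [← Matrix.trace_transpose, Matrix.transpose_mul, Matrix.transpose_transpose]
  simp only [fnorm_sq, Matrix.transpose_sub, Matrix.transpose_smul, Matrix.sub_mul,
    Matrix.mul_sub, Matrix.smul_mul, Matrix.mul_smul, Matrix.trace_sub, Matrix.trace_smul,
    smul_eq_mul, symm Y Z, symm X Z, symm Y X]
  ring

theorem trace_transpose_mul_left_gram {m n r : ℕ} (G : Matrix (Fin m) (Fin n) ℝ)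
    (A : Matrix (Fin m) (Fin r) ℝ) : (Gᵀ * (A * Aᵀ * G)).trace = fnorm (Aᵀ * G) ^ 2 := by
  simp [fnorm_sq, Matrix.mul_assoc]

theorem trace_transpose_mul_right_gram {m n r : ℕ} (G : Matrix (Fin m) (Fin n) ℝ)
    (B : Matrix (Fin n) (Fin r) ℝ) : (Gᵀ * (G * B * Bᵀ)).trace = fnorm (G * B) ^ 2 := by
  rw [fnorm_sq, ← Matrix.mul_assoc, Matrix.trace_mul_comm]
  simp [Matrix.mul_assoc]

theorem trace_left_gram_mul_right_gram {m n r : ℕ} (G : Matrix (Fin m) (Fin n) ℝ)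
    (A : Matrix (Fin m) (Fin r) ℝ) (B : Matrix (Fin n) (Fin r) ℝ) :
    ((A * Aᵀ * G)ᵀ * (G * B * Bᵀ)).trace = fnorm (Aᵀ * G * B) ^ 2 := by
  rw [fnorm_sq, ← Matrix.mul_assoc, Matrix.trace_mul_comm]
  simp [Matrix.mul_assoc]

theorem stmt4 {m n r : ℕ} (hm : 0 < m) (hn : 0 < n) (hr : 0 < r)
    (L η : ℝ) (hL : 0 < L) (hη : 0 < η)
    (G : Matrix (Fin m) (Fin n) ℝ)
    (A : Matrix (Fin m) (Fin r) ℝ) (B : Matrix (Fin n) (Fin r) ℝ)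
    (hnz : ¬(Aᵀ * G = 0 ∧ G * B = 0))
    (hCA : 0 ≤ CA G A B) (hCB : 0 ≤ CB G A B) (hC : 0 < CC G A B) :
    ∀ αs βs : ℝ,
      αs ^ 2 = CA G A B / (L * η * CC G A B) →
      βs ^ 2 = CB G A B / (L * η * CC G A B) →
      ∀ α β : ℝ, scalObj L η G A B αs βs ≤ scalObj L η G A B α β := by
  intro αs βs hα hβ α β
  have hquad (x y : ℝ) := sq_nonneg
    (fnorm ((0 : ℝ) • G - y • (G * B * Bᵀ) - x • (A * Aᵀ * G)))
  simp only [scalObj]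
  refine mul_le_mul_of_nonneg_left ?_ (by positivity)
  simp only [fnorm_sq_sub_sub, trace_transpose_mul_left_gram, trace_transpose_mul_right_gram,
    trace_left_gram_mul_right_gram] at hquad ⊢
  rw [hα, hβ]
  unfold CA CB
  have hCC : CC G A B = fnorm (A * Aᵀ * G) ^ 2 * fnorm (G * B * Bᵀ) ^ 2
    - (fnorm (Aᵀ * G * B) ^ 2) ^ 2 := by rw [CC]; ring
  generalize CC G A B = C at *
  generalize fnorm (A * Aᵀ * G) ^ 2 = P at *
  generalize fnorm (G * B * Bᵀ) ^ 2 = Q at *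
  generalize fnorm (Aᵀ * G * B) ^ 2 = R at *
  generalize fnorm (Aᵀ * G) ^ 2 = a at *
  generalize fnorm (G * B) ^ 2 = b at *
  set x := (a * Q - b * R) / (L * η * C) with hx
  set y := (b * P - a * R) / (L * η * C) with hy
  have hP : x * P + y * R = a / (L * η) := by
    rw [hx, hy]; field_simp; rw [hCC]; ring
  have hQ : x * R + y * Q = b / (L * η) := by
    rw [hx, hy]; field_simp; rw [hCC]; ring
  have ha : 1 / L * a = η * (x * P + y * R) := by rw [hP]; field_simp
  have hb : 1 / L * b = η * (x * R + y * Q) := by rw [hQ]; field_simp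
  have h := hquad (η * (α ^ 2 - x)) (η * (β ^ 2 - y))
  linear_combination h + 2 * η * (α ^ 2 - x) * ha + 2 * η * (β ^ 2 - y) * hb
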